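/- Let S be a finite block-group and s, t ∈ S. Then for every x ∈ S: x ∈ 𝒟(st) if and only if x ∈ 𝒟(s) and xs ∈ 𝒟(t). Consequently, the partial map φ_{st} : 𝒟(st) → ℐ(st), x ↦ x(st), is the composition of φ_s : 𝒟(s) → ℐ(s), x ↦ xs, and φ_t : 𝒟(t) → ℐ(t), x ↦ xt, so that s ↦ φ_s is a homomorphism from S into the symmetric inverse semigroup on S. -/

import Mathlib

/-- A (finite) semigroup is a block-group iff every element has at most one inverse. -/
def IsBlockGroup (S : Type*) [Semigroup S] : Prop :=
  ∀ a b c : S, a * b * a = a → b * a * b = b → a * c * a = a → c * a * c = c → b = c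

/-- `a ≤_R b` : `a ∈ b S¹`. -/
def leR {S : Type*} [Semigroup S] (a b : S) : Prop := a = b ∨ ∃ x, a = b * x

/-- `a ≤_L b` : `a ∈ S¹ b`. -/
def leL {S : Type*} [Semigroup S] (a b : S) : Prop := a = b ∨ ∃ x, a = x * b

/-- Green's relation ℛ : `a S¹ = b S¹`. -/
def RRel {S : Type*} [Semigroup S] (a b : S) : Prop := leR a b ∧ leR b a

/-- Green's relation ℒ : `S¹ a = S¹ b`. -/
def LRel {S : Type*} [Semigroup S] (a b : S) : Prop := leL a b ∧ leL b a

/-- An element is regular if `a y a = a` for some `y`. -/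
def IsRegularElem {S : Type*} [Semigroup S] (a : S) : Prop := ∃ y, a * y * a = a

/-- `x ∈ 𝒟(s)` : `x = x e` for some idempotent `e ≤_R s`. -/
def inD {S : Type*} [Semigroup S] (s x : S) : Prop :=
  ∃ e, e * e = e ∧ leR e s ∧ x = x * e

/-- `x ∈ ℐ(s)` : `x = x e` for some idempotent `e ≤_L s`. -/
def inI {S : Type*} [Semigroup S] (s x : S) : Prop :=
  ∃ e, e * e = e ∧ leL e s ∧ x = x * e

/-- `spow a n = a ^ (n+1)` : positive powers in a semigroup. -/
def spow {S : Type*} [Semigroup S] (a : S) : ℕ → S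
  | 0 => a
  | n + 1 => spow a n * a

theorem leR_iff_exists_eq_mul_of_idempotent {S : Type*} [Semigroup S] {e s : S}
    (he : e * e = e) : leR e s ↔ ∃ u, e = s * u := by
  refine ⟨?_, Or.inr⟩
  rintro (rfl | h)
  · exact ⟨e, he.symm⟩
  · exact h

/-- In a finite semigroup, `x ∈ 𝒟(s)` iff `x` is fixed by right multiplication by some element
of `s S`. -/
theorem inD_iff_exists_eq_mul {S : Type*} [Semigroup S] [Finite S] {s x : S} :
    inD s x ↔ ∃ u, x = x * (s * u) := by
  constructor
  · rintro ⟨e, he, hes, hx⟩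
    obtain ⟨u, rfl⟩ := (leR_iff_exists_eq_mul_of_idempotent he).1 hes
    exact ⟨u, hx⟩
  · rintro ⟨u, hu⟩
    let : TopologicalSpace S := ⊥
    have : DiscreteTopology S := ⟨rfl⟩
    obtain ⟨e, ⟨hx, v, hv⟩, he⟩ := exists_idempotent_in_compact_subsemigroup
      (fun _ => continuous_of_discreteTopology) {y : S | x = x * y ∧ ∃ v, y = s * v}
      ⟨s * u, hu, u, rfl⟩ (Set.toFinite _).isCompact (by
        rintro a ⟨ha, v, rfl⟩ b ⟨hb, -⟩
        exact ⟨by rw [← mul_assoc, ← ha, ← hb], v * b, mul_assoc _ _ _⟩)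
    exact ⟨e, he, Or.inr ⟨v, hv⟩, hx⟩

theorem inD_mul_iff {S : Type*} [Semigroup S] [Finite S] {s t x : S} :
    inD (s * t) x ↔ inD s x ∧ inD t (x * s) := by
  simp only [inD_iff_exists_eq_mul]
  constructor
  · rintro ⟨u, hu⟩
    refine ⟨⟨t * u, by rwa [← mul_assoc s]⟩, u * s, ?_⟩
    calc x * s = x * (s * t * u) * s := by rw [← hu]
      _ = x * s * (t * (u * s)) := by simp only [mul_assoc]
  · rintro ⟨⟨u, hu⟩, v, hv⟩
    refine ⟨v * u, ?_⟩
    calc x = x * s * u := by rw [mul_assoc, ← hu]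
      _ = x * s * (t * v) * u := by rw [← hv]
      _ = x * (s * t * (v * u)) := by simp only [mul_assoc]

theorem stmt_14 {S : Type*} [Semigroup S] [Fintype S] (hS : IsBlockGroup S)
    (s t : S) :
    (∀ x : S, inD (s * t) x ↔ (inD s x ∧ inD t (x * s))) ∧
    (∀ x : S, inD (s * t) x → x * (s * t) = (x * s) * t) :=
  ⟨fun _ => inD_mul_iff, fun x _ => (mul_assoc x s t).symm⟩
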